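/- arXiv:1211.3248 — 5 statements merged into one kernel-verified Lean document; each statement's English description precedes it below -/
import Mathlib

section
/- Let n ≥ 1 be an integer, let h be the largest order of a Hadamard matrix with h ≤ n, and let d = n − h. Then D̄(n) > 0.07·(0.352)^d > 3^{−(d+3)}. -/
/-- An `h × h` Hadamard matrix: entries in `{−1, 1}` and `A * Aᵀ = h • I`. -/
def IsHadamardMatrix {h : ℕ} (A : Matrix (Fin h) (Fin h) ℝ) : Prop :=
  (∀ i j, A i j = 1 ∨ A i j = -1) ∧ A * A.transpose = (h : ℝ) • 1

/-- `h` is the order of some Hadamard matrix. -/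
def IsHadamardOrder (h : ℕ) : Prop :=
  ∃ A : Matrix (Fin h) (Fin h) ℝ, IsHadamardMatrix A

/-- `maxDet n = D(n)`: the maximum of `|det M|` over `n × n` `{±1}`-matrices `M`. -/
noncomputable def maxDet (n : ℕ) : ℝ :=
  sSup {x : ℝ | ∃ M : Matrix (Fin n) (Fin n) ℝ,
    (∀ i j, M i j = 1 ∨ M i j = -1) ∧ x = |M.det|}

/-- `maxDetBar n = D̄(n) = D(n) / n^(n/2)`. -/
noncomputable def maxDetBar (n : ℕ) : ℝ :=
  maxDet n / (n : ℝ) ^ ((n : ℝ) / 2)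

open Finset

namespace Real

/-- The tangent line of `sin` at `π / 3` lies above the graph. -/
lemma sin_le_tangent_pi_div_three {y : ℝ} (h0 : 0 ≤ y) :
    sin y ≤ √3 / 2 + (y - π / 3) / 2 := by
  have hs3 : (1.7 : ℝ) < √3 := lt_sqrt_of_sq_lt (by norm_num)
  rcases le_total (π / 3) y with h | h
  · obtain ⟨w, hw, rfl⟩ : ∃ w, 0 ≤ w ∧ y = π / 3 + w := ⟨y - π / 3, by linarith, by ring⟩
    rw [sin_add, sin_pi_div_three, cos_pi_div_three]
    nlinarith [sin_le hw, cos_le_one w]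
  · obtain ⟨w, hw, rfl⟩ : ∃ w, 0 ≤ w ∧ y = π / 3 - w := ⟨π / 3 - y, by linarith, by ring⟩
    rw [sin_sub, sin_pi_div_three, cos_pi_div_three]
    have hpi := pi_lt_d2
    have hpi0 := pi_pos
    have hw1 : w ≤ 1.05 := by linarith
    have h1 := sin_ge_sub_cube hw
    have h2 := cos_le_one_sub_mul_cos_sq (x := w) (by rw [abs_of_nonneg hw]; linarith)
    have h3 : (0.2 : ℝ) ≤ 2 / π ^ 2 := by
      rw [le_div_iff₀ (by positivity)]
      nlinarith
    have h4 : 0.2 * w ^ 2 ≤ 1 - cos w := by nlinarith [sq_nonneg w]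
    have h5 : w ^ 3 ≤ 1.05 * w ^ 2 := by nlinarith [sq_nonneg w]
    nlinarith [sq_nonneg w]

lemma one_sub_cos_le_mul_abs (x : ℝ) : 1 - cos x ≤ 0.765 * |x| := by
  rw [← cos_abs]
  obtain ⟨y, hy, hx⟩ : ∃ y, 0 ≤ y ∧ |x| = 2 * y := ⟨|x| / 2, by positivity, by ring⟩
  rw [hx, cos_two_mul]
  suffices h : sin y ^ 2 ≤ 0.765 * y by linarith [sin_sq_add_cos_sq y]
  rcases le_total y 0.765 with h1 | h1
  · nlinarith [sin_sq_le_sq (x := y)]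
  rcases le_total 1.31 y with h2 | h2
  · nlinarith [sin_sq_le_one y]
  have hs3 : √3 < 1.73206 := (sqrt_lt' (by norm_num)).2 (by norm_num)
  have ht : sin y ≤ y / 2 + 0.3426 := by
    linarith [sin_le_tangent_pi_div_three hy, pi_gt_d4]
  have hs : 0 ≤ sin y := sin_nonneg_of_nonneg_of_le_pi hy (by linarith [pi_gt_three])
  nlinarith

lemma cos_le_exp_neg_sq_div_two {x : ℝ} (hx : |x| ≤ π / 2) : cos x ≤ exp (-(x ^ 2 / 2)) := by
  rw [← cos_abs, ← sq_abs]
  set y := |x| with hy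
  have hanti : AntitoneOn (fun z : ℝ => cos z * exp (z ^ 2 / 2)) (Set.Icc 0 (π / 2)) := by
    refine antitoneOn_of_deriv_nonpos (convex_Icc _ _) (by fun_prop) (by fun_prop) ?_
    intro z hz
    rw [interior_Icc] at hz
    have hd : HasDerivAt (fun z : ℝ => cos z * exp (z ^ 2 / 2))
        (-sin z * exp (z ^ 2 / 2) + cos z * (exp (z ^ 2 / 2) * z)) z := by
      have h1 : HasDerivAt (fun z : ℝ => z ^ 2 / 2) z z := by
        simpa using (hasDerivAt_pow 2 z).div_const 2
      exact (hasDerivAt_cos z).mul h1.exp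
    rw [hd.deriv]
    have hc : 0 < cos z := cos_pos_of_mem_Ioo ⟨by linarith [hz.1, pi_pos], hz.2⟩
    have h2 := lt_tan hz.1 hz.2
    rw [tan_eq_sin_div_cos, lt_div_iff₀ hc] at h2
    nlinarith [exp_pos (z ^ 2 / 2)]
  have h := hanti ⟨le_rfl, by positivity⟩ ⟨abs_nonneg x, hx⟩ (abs_nonneg x)
  simp only [cos_zero, ne_eq, OfNat.ofNat_ne_zero, not_false_eq_true, zero_pow, zero_div,
    exp_zero, mul_one, ← hy] at h
  rw [exp_neg, ← one_div, le_div_iff₀ (exp_pos _)]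
  exact h

lemma exp_neg_nine_eighths_le : exp (-(9 / 8)) ≤ 0.325 := by
  have h1 : (2.7182818283 : ℝ) ^ 9 ≤ exp (9 / 8) ^ 8 := by
    rw [← exp_nat_mul, show ((8 : ℕ) : ℝ) * (9 / 8) = ((9 : ℕ) : ℝ) * 1 by norm_num, exp_nat_mul]
    exact pow_le_pow_left₀ (by norm_num) exp_one_gt_d9.le 9
  have h2 : (1 / 0.325 : ℝ) ≤ exp (9 / 8) := by
    refine le_of_pow_le_pow_left₀ (n := 8) (by norm_num) (exp_pos _).le (le_trans ?_ h1)
    norm_num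
  rw [exp_neg, inv_le_comm₀ (exp_pos _) (by norm_num)]
  simpa using h2

end Real

section Signs

variable {ι : Type*} [Fintype ι] [DecidableEq ι]

/-- The sign vectors indexed by `ι`. -/
noncomputable def signVectors (ι : Type*) [Fintype ι] [DecidableEq ι] : Finset (ι → ℝ) :=
  Fintype.piFinset fun _ => {1, -1}

lemma mem_signVectors {ε : ι → ℝ} : ε ∈ signVectors ι ↔ ∀ i, ε i = 1 ∨ ε i = -1 := by
  simp [signVectors]

lemma card_signVectors : ((signVectors ι).card : ℝ) = 2 ^ Fintype.card ι := by
  have h : ({1, -1} : Finset ℝ).card = 2 := Finset.card_pair (by norm_num)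
  simp [signVectors, Fintype.card_piFinset, h]

lemma sum_cos_signVectors (a : ι → ℝ) :
    ∑ ε ∈ signVectors ι, Real.cos (∑ i, a i * ε i) = ∏ i, (2 * Real.cos (a i)) := by
  have h := Finset.prod_univ_sum (fun _ : ι => ({1, -1} : Finset ℝ))
    (fun i s => Complex.exp ((a i * s : ℝ) * Complex.I))
  have hl : ∀ i : ι, ∑ s ∈ ({1, -1} : Finset ℝ), Complex.exp ((a i * s : ℝ) * Complex.I)
      = ((2 * Real.cos (a i) : ℝ) : ℂ) := by
    intro i
    rw [Finset.sum_pair (by norm_num)]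
    push_cast
    rw [Complex.two_cos]
    simp
  simp only [hl, ← Complex.exp_sum, ← Finset.sum_mul, ← Complex.ofReal_sum,
    ← Complex.ofReal_prod] at h
  have hre := congrArg Complex.re h
  rw [Complex.ofReal_re, Complex.re_sum] at hre
  simp only [Complex.exp_ofReal_mul_I_re] at hre
  exact hre.symm

/-- A lower Khintchine inequality with constant `0.588`. -/
lemma khintchine_lower (a : ι → ℝ) :
    2 ^ Fintype.card ι * (0.588 * √(∑ i, a i ^ 2)) ≤
      ∑ ε ∈ signVectors ι, |∑ i, a i * ε i| := by
  set r := √(∑ i, a i ^ 2) with hr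
  have hr2 : r ^ 2 = ∑ i, a i ^ 2 := Real.sq_sqrt (by positivity)
  rcases (Real.sqrt_nonneg (∑ i, a i ^ 2)).eq_or_lt with h0 | hpos
  · rw [hr, ← h0]
    simp only [mul_zero]
    positivity
  rw [← hr] at hpos
  set t := 3 / (2 * r) with ht
  have htr : t * r = 3 / 2 := by rw [ht]; field_simp
  have ht0 : 0 < t := by positivity
  have hcos : ∀ i, |t * a i| ≤ Real.pi / 2 := by
    intro i
    have h1 : |a i| ≤ r := by
      refine abs_le_of_sq_le_sq ?_ hpos.le
      rw [hr2]
      exact Finset.single_le_sum (f := fun i => a i ^ 2) (fun _ _ => sq_nonneg _) (mem_univ i)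
    rw [abs_mul, abs_of_pos ht0]
    nlinarith [Real.pi_gt_three]
  have hprod : ∏ i, (2 * Real.cos (t * a i)) ≤ 2 ^ Fintype.card ι * 0.325 := by
    rw [Finset.prod_mul_distrib, Finset.prod_const, Finset.card_univ]
    gcongr
    calc ∏ i, Real.cos (t * a i) ≤ ∏ i, Real.exp (-((t * a i) ^ 2 / 2)) :=
          Finset.prod_le_prod (fun i _ => Real.cos_nonneg_of_mem_Icc (abs_le.1 (hcos i)))
            fun i _ => Real.cos_le_exp_neg_sq_div_two (hcos i)
      _ = Real.exp (-(9 / 8)) := by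
          rw [← Real.exp_sum]
          congr 1
          simp only [mul_pow]
          rw [Finset.sum_neg_distrib, ← Finset.sum_div, ← Finset.mul_sum, ← hr2, ← mul_pow, htr]
          norm_num
      _ ≤ 0.325 := Real.exp_neg_nine_eighths_le
  have hsum : ∑ ε ∈ signVectors ι, (1 - Real.cos (∑ i, t * a i * ε i)) ≤
      ∑ ε ∈ signVectors ι, 0.765 * (t * |∑ i, a i * ε i|) := by
    refine Finset.sum_le_sum fun ε _ => ?_
    have h := Real.one_sub_cos_le_mul_abs (∑ i, t * a i * ε i)
    rwa [show |∑ i, t * a i * ε i| = t * |∑ i, a i * ε i| by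
      simp only [mul_assoc, ← Finset.mul_sum]
      rw [abs_mul, abs_of_pos ht0]] at h
  rw [Finset.sum_sub_distrib, sum_cos_signVectors, ← Finset.mul_sum, ← Finset.mul_sum,
    Finset.sum_const, nsmul_eq_mul, mul_one, card_signVectors] at hsum
  set T := ∑ ε ∈ signVectors ι, |∑ i, a i * ε i|
  have hp : (0 : ℝ) < 2 ^ Fintype.card ι := by positivity
  have h1 : 2 ^ Fintype.card ι * 0.675 ≤ 0.765 * (t * T) := by linarith
  have h2 : r * (2 ^ Fintype.card ι * 0.675) ≤ 0.765 * (t * r * T) := by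
    nlinarith [mul_le_mul_of_nonneg_left h1 hpos.le]
  rw [htr] at h2
  nlinarith [mul_pos hpos hp]

end Signs

section Bordering

open Matrix

/-- A sign matrix of order `n` can be bordered by a row and a column so that its determinant grows
at least by a factor `1 + 0.588 √n`. -/
lemma exists_bordered_sign_matrix {n : ℕ} (hn : 1 ≤ n) (M : Matrix (Fin n) (Fin n) ℝ)
    (hM : ∀ i j, M i j = 1 ∨ M i j = -1) (hdet : M.det ≠ 0) :
    ∃ N : Matrix (Fin (n + 1)) (Fin (n + 1)) ℝ, (∀ i j, N i j = 1 ∨ N i j = -1) ∧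
      (1 + 0.588 * √n) * |M.det| ≤ |N.det| := by
  have hn0 : (0 : ℝ) < n := by exact_mod_cast hn
  have hrow : ∀ i, 1 / √n ≤ √(∑ k, M⁻¹ i k ^ 2) := by
    intro i
    have h1 : ∑ k, M⁻¹ i k * M k i = 1 := by
      rw [← Matrix.mul_apply, Matrix.nonsing_inv_mul _ (isUnit_iff_ne_zero.2 hdet)]
      simp
    have h2 := Finset.sum_mul_sq_le_sq_mul_sq univ (fun k => M⁻¹ i k) (fun k => M k i)
    have h3 : ∑ k, M k i ^ 2 = n := by
      rw [Finset.sum_congr rfl (g := fun _ => (1 : ℝ))]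
      · simp
      · intro k _
        rcases hM k i with h | h <;> simp [h]
    rw [h1, h3] at h2
    rw [← Real.sqrt_one, ← Real.sqrt_div zero_le_one]
    refine Real.sqrt_le_sqrt ?_
    rw [div_le_iff₀ hn0]
    simpa using h2
  obtain ⟨b, hb, hbs⟩ : ∃ b ∈ signVectors (Fin n),
      0.588 * √n ≤ ∑ i, |∑ k, M⁻¹ i k * b k| := by
    refine Finset.exists_le_of_sum_le ⟨fun _ => 1, mem_signVectors.2 fun _ => Or.inl rfl⟩ ?_
    rw [Finset.sum_comm, Finset.sum_const, nsmul_eq_mul, card_signVectors]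
    calc (2 : ℝ) ^ Fintype.card (Fin n) * (0.588 * √n)
        = ∑ i : Fin n, 2 ^ Fintype.card (Fin n) * (0.588 * (1 / √n)) := by
          rw [Finset.sum_const, nsmul_eq_mul, Finset.card_univ]
          simp only [Fintype.card_fin]
          field_simp
          rw [Real.sq_sqrt hn0.le]
      _ ≤ ∑ i : Fin n, 2 ^ Fintype.card (Fin n) * (0.588 * √(∑ k, M⁻¹ i k ^ 2)) := by
          gcongr with i
          exact hrow i
      _ ≤ _ := Finset.sum_le_sum fun i _ => khintchine_lower _
  rw [mem_signVectors] at hb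
  choose c hc hcs using fun i => show ∃ s : ℝ, (s = 1 ∨ s = -1) ∧
      s * (M⁻¹ *ᵥ b) i = -|(M⁻¹ *ᵥ b) i| by
    rcases abs_cases ((M⁻¹ *ᵥ b) i) with h | h
    · exact ⟨-1, Or.inr rfl, by rw [h.1]; ring⟩
    · exact ⟨1, Or.inl rfl, by rw [h.1]; ring⟩
  let P : Matrix (Fin n ⊕ Fin 1) (Fin n ⊕ Fin 1) ℝ :=
    fromBlocks M (of fun i _ => b i) (of fun _ j => c j) 1
  have hP : P.det = M.det * (1 + ∑ i, |(M⁻¹ *ᵥ b) i|) := by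
    let := M.invertibleOfIsUnitDet (isUnit_iff_ne_zero.2 hdet)
    rw [det_fromBlocks₁₁, det_fin_one, invOf_eq_nonsing_inv, Matrix.mul_assoc]
    congr 1
    have : ((of fun (_ : Fin 1) j => c j) * (M⁻¹ * (of fun i (_ : Fin 1) => b i))) 0 0 =
        ∑ i, c i * (M⁻¹ *ᵥ b) i := rfl
    rw [Matrix.sub_apply, this, Matrix.one_apply_eq, Finset.sum_congr rfl fun i _ => hcs i,
      Finset.sum_neg_distrib, sub_neg_eq_add]
  refine ⟨P.reindex finSumFinEquiv finSumFinEquiv, ?_, ?_⟩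
  · have hs : ∀ i j, P i j = 1 ∨ P i j = -1 := by
      rintro (i | i) (j | j)
      · exact hM i j
      · exact hb i
      · exact hc j
      · left
        simp [P, Subsingleton.elim i j]
    exact fun i j => hs _ _
  · rw [det_reindex_self, hP, abs_mul, abs_of_nonneg (by positivity : (0 : ℝ) ≤ 1 + _), mul_comm]
    gcongr
    exact hbs

lemma abs_det_le_maxDet {n : ℕ} (M : Matrix (Fin n) (Fin n) ℝ)
    (hM : ∀ i j, M i j = 1 ∨ M i j = -1) : |M.det| ≤ maxDet n := by
  refine le_csSup ⟨n.factorial, ?_⟩ ⟨M, hM, rfl⟩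
  rintro x ⟨N, hN, rfl⟩
  have h := Matrix.det_le (A := N) (abv := AbsoluteValue.abs) (x := 1) (by
    intro i j
    rcases hN i j with h | h <;> simp [h])
  simpa using h

lemma IsHadamardMatrix.sq_det {h : ℕ} {A : Matrix (Fin h) (Fin h) ℝ} (hA : IsHadamardMatrix A) :
    A.det ^ 2 = (h : ℝ) ^ h := by
  have := congrArg Matrix.det hA.2
  rwa [det_mul, det_transpose, det_smul, det_one, mul_one, Fintype.card_fin, ← sq] at this

/-- The growth of the squared Hadamard bound is controlled by that of a bordered determinant. -/
lemma mul_succ_pow_succ_le {n : ℕ} (hn : 1 ≤ n) :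
    (0.352 : ℝ) ^ 2 * ((n + 1 : ℕ) : ℝ) ^ (n + 1) ≤ (1 + 0.588 * √n) ^ 2 * (n : ℝ) ^ n := by
  have hn0 : (0 : ℝ) < n := by exact_mod_cast hn
  have hs : √n ^ 2 = (n : ℝ) := Real.sq_sqrt hn0.le
  have h1 : (0.588 : ℝ) ^ 2 * (n + 1) ≤ (1 + 0.588 * √n) ^ 2 := by
    nlinarith [Real.sqrt_nonneg (n : ℝ)]
  have h2 : ((n : ℝ) + 1) ^ n ≤ Real.exp 1 * (n : ℝ) ^ n := by
    have h := Real.one_add_inv_pow_le_exp (n := n)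
    have h3 : ((n : ℝ) + 1) ^ n = (1 + (n : ℝ)⁻¹) ^ n * (n : ℝ) ^ n := by
      rw [← mul_pow]
      congr 1
      field_simp
    rw [h3]
    gcongr
  push_cast
  calc (0.352 : ℝ) ^ 2 * ((n : ℝ) + 1) ^ (n + 1)
      = 0.352 ^ 2 * (n + 1) * (n + 1) ^ n := by ring
    _ ≤ 0.352 ^ 2 * (n + 1) * (Real.exp 1 * (n : ℝ) ^ n) := by gcongr
    _ = (0.352 ^ 2 * Real.exp 1) * (n + 1) * (n : ℝ) ^ n := by ring
    _ ≤ 0.588 ^ 2 * (n + 1) * (n : ℝ) ^ n := by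
        gcongr
        nlinarith [Real.exp_one_lt_d9]
    _ ≤ _ := by gcongr

lemma exists_sign_matrix_of_isHadamardOrder {h : ℕ} (hh : 1 ≤ h) (hH : IsHadamardOrder h) (d : ℕ) :
    ∃ M : Matrix (Fin (h + d)) (Fin (h + d)) ℝ, (∀ i j, M i j = 1 ∨ M i j = -1) ∧
      ((0.352 : ℝ) ^ d) ^ 2 * ((h + d : ℕ) : ℝ) ^ (h + d) ≤ M.det ^ 2 := by
  induction d with
  | zero =>
    obtain ⟨A, hA⟩ := hH
    exact ⟨A, hA.1, by simp [hA.sq_det]⟩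
  | succ d ih =>
    obtain ⟨M, hM, hdet⟩ := ih
    have hn : 1 ≤ h + d := by omega
    have hn0 : (0 : ℝ) < ((h + d : ℕ) : ℝ) := by exact_mod_cast hn
    have hdet0 : M.det ≠ 0 := by
      have : 0 < M.det ^ 2 := lt_of_lt_of_le (by positivity) hdet
      exact fun h0 => by simp [h0] at this
    obtain ⟨N, hN, hND⟩ := exists_bordered_sign_matrix hn M hM hdet0
    refine ⟨N, hN, ?_⟩
    have hsq := pow_le_pow_left₀ (by positivity) hND 2
    rw [mul_pow, sq_abs, sq_abs] at hsq
    calc ((0.352 : ℝ) ^ (d + 1)) ^ 2 * ((h + (d + 1) : ℕ) : ℝ) ^ (h + (d + 1))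
        = ((0.352 : ℝ) ^ d) ^ 2 *
          (0.352 ^ 2 * ((h + d + 1 : ℕ) : ℝ) ^ (h + d + 1)) := by
          rw [← add_assoc]; ring
      _ ≤ ((0.352 : ℝ) ^ d) ^ 2 *
          ((1 + 0.588 * √((h + d : ℕ) : ℝ)) ^ 2 * ((h + d : ℕ) : ℝ) ^ (h + d)) :=
          mul_le_mul_of_nonneg_left (mul_succ_pow_succ_le hn) (by positivity)
      _ = (1 + 0.588 * √((h + d : ℕ) : ℝ)) ^ 2 *
          (((0.352 : ℝ) ^ d) ^ 2 * ((h + d : ℕ) : ℝ) ^ (h + d)) := by ring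
      _ ≤ (1 + 0.588 * √((h + d : ℕ) : ℝ)) ^ 2 * M.det ^ 2 := by gcongr
      _ ≤ N.det ^ 2 := hsq

lemma isHadamardOrder_one : IsHadamardOrder 1 :=
  ⟨Matrix.of fun _ _ => 1, fun _ _ => Or.inl rfl, by
    ext i j; fin_cases i; fin_cases j; simp [Matrix.mul_apply]⟩

lemma le_maxDetBar_add {h : ℕ} (hh : 1 ≤ h) (hH : IsHadamardOrder h) (d : ℕ) :
    (0.352 : ℝ) ^ d ≤ maxDetBar (h + d) := by
  obtain ⟨M, hM, hdet⟩ := exists_sign_matrix_of_isHadamardOrder hh hH d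
  have hn0 : (0 : ℝ) < ((h + d : ℕ) : ℝ) := by exact_mod_cast (by omega : 0 < h + d)
  rw [maxDetBar, le_div_iff₀ (by positivity)]
  refine le_trans ?_ (abs_det_le_maxDet M hM)
  refine le_of_sq_le_sq ?_ (abs_nonneg _)
  rw [mul_pow, sq_abs, ← Real.rpow_natCast (_ ^ (_ / 2)), ← Real.rpow_mul hn0.le,
    Nat.cast_ofNat, div_mul_cancel₀ _ two_ne_zero, Real.rpow_natCast]
  exact hdet

end Bordering

theorem maxDetBar_no_exceptions (n h d : ℕ) (hn : 1 ≤ n)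
    (hH : IsHadamardOrder h) (hhn : h ≤ n)
    (hmax : ∀ h' : ℕ, IsHadamardOrder h' → h' ≤ n → h' ≤ h)
    (hd : d = n - h) :
    maxDetBar n > 0.07 * (0.352 : ℝ) ^ d ∧
    0.07 * (0.352 : ℝ) ^ d > (3 : ℝ) ^ (-((d : ℤ) + 3)) := by
  have hh : 1 ≤ h := hmax 1 isHadamardOrder_one hn
  obtain rfl : n = h + d := by omega
  refine ⟨lt_of_lt_of_le ?_ (le_maxDetBar_add hh hH d), ?_⟩
  · have : (0 : ℝ) < 0.352 ^ d := by positivity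
    linarith
  · have h3 : (3 : ℝ) ^ (-((d : ℤ) + 3)) = 1 / 27 * (1 / 3) ^ d := by
      rw [zpow_neg, zpow_add₀ (by norm_num), zpow_natCast, one_div_pow]
      norm_num
    rw [h3]
    have h4 : (1 / 3 : ℝ) ^ d ≤ 0.352 ^ d := by gcongr; norm_num
    have : (0 : ℝ) < 0.352 ^ d := by positivity
    linarith
end

section
/- Suppose there exist real constants α > 0 and β such that for every odd positive integer q and every integer t ≥ α·log₂(q) + β, there exists a Hadamard matrix of order 2^t·q. Then there exists a constant K > 0 such that for every order n₀ of a Hadamard matrix there is an order n₁ of a Hadamard matrix with n₀ < n₁ ≤ n₀ + K·n₀^{α/(1+α)}; in other words, the gap between consecutive Hadamard orders up to x is O(x^{α/(1+α)}). -/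
/-- The hypothesis on odd `q` extends to all positive `m`: the factors of two in `m` can be moved
into the power of two. -/
theorem isHadamardOrder_two_pow_mul {α β : ℝ} (hα : 0 < α)
    (hyp : ∀ q : ℕ, Odd q → 0 < q → ∀ t : ℕ,
      (t : ℝ) ≥ α * Real.logb 2 (q : ℝ) + β → IsHadamardOrder (2 ^ t * q))
    {m t : ℕ} (hm : 0 < m) (ht : α * Real.logb 2 (m : ℝ) + β ≤ t) :
    IsHadamardOrder (2 ^ t * m) := by
  obtain ⟨s, q, hq, rfl⟩ := Nat.exists_eq_two_pow_mul_odd hm.ne'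
  rw [← mul_assoc, ← pow_add]
  refine hyp q hq hq.pos (t + s) ?_
  have hq0 : (0 : ℝ) < q := by exact_mod_cast hq.pos
  have hle : (q : ℝ) ≤ ((2 ^ s * q : ℕ) : ℝ) := by
    exact_mod_cast Nat.le_mul_of_pos_left q (by positivity)
  have hlog := mul_le_mul_of_nonneg_left
    (Real.logb_le_logb_of_le (b := 2) (by norm_num) hq0 hle) hα.le
  push_cast at hlog ht ⊢
  linarith [(Nat.cast_nonneg s : (0 : ℝ) ≤ s)]

theorem hadamard_gap_bound (α β : ℝ) (hα : 0 < α)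
    (hyp : ∀ q : ℕ, Odd q → 0 < q → ∀ t : ℕ,
      (t : ℝ) ≥ α * Real.logb 2 (q : ℝ) + β → IsHadamardOrder (2 ^ t * q)) :
    ∃ K : ℝ, 0 < K ∧ ∀ n₀ : ℕ, 0 < n₀ → IsHadamardOrder n₀ →
      ∃ n₁ : ℕ, IsHadamardOrder n₁ ∧ n₀ < n₁ ∧
        (n₁ : ℝ) ≤ (n₀ : ℝ) + K * (n₀ : ℝ) ^ (α / (1 + α)) := by
  set C : ℝ := max 1 (2 ^ (α + β))
  have hC1 : 1 ≤ C := le_max_left _ _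
  refine ⟨2 * C, by positivity, fun n hn _ => ?_⟩
  have hn1 : (1 : ℝ) ≤ n := by exact_mod_cast hn
  have hn0 : (0 : ℝ) < n := by positivity
  set x : ℝ := (n : ℝ) ^ (α / (1 + α)) with hx
  set y : ℝ := (n : ℝ) ^ (1 / (1 + α)) with hy
  have hx1 : 1 ≤ x := Real.one_le_rpow hn1 (by positivity)
  have hy1 : 1 ≤ y := Real.one_le_rpow hn1 (by positivity)
  have hxy : x * y = n := by
    rw [hx, hy, ← Real.rpow_add hn0, ← add_div, add_comm α 1, div_self (by positivity),
      Real.rpow_one]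
  have hyx : y ^ α = x := by
    rw [hx, hy, ← Real.rpow_mul hn0.le]
    congr 1
    ring
  obtain ⟨k, hk, hk'⟩ := exists_nat_pow_near (one_le_mul_of_one_le_of_one_le hC1 hx1)
    (one_lt_two : (1 : ℝ) < 2)
  set m : ℕ := n / 2 ^ (k + 1) + 1 with hm
  have hm0 : (0 : ℝ) < m := by positivity
  have hmy : (m : ℝ) ≤ 2 * y := by
    have hdiv : ((n / 2 ^ (k + 1) : ℕ) : ℝ) ≤ y := by
      refine Nat.cast_div_le.trans ?_
      push_cast
      rw [div_le_iff₀ (by positivity), ← hxy, mul_comm x y]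
      exact mul_le_mul_of_nonneg_left (by nlinarith) (by positivity)
    rw [hm]
    push_cast at hdiv ⊢
    linarith
  have hpow : (2 : ℝ) ^ β * (m : ℝ) ^ α ≤ 2 ^ (k + 1) := calc
    (2 : ℝ) ^ β * (m : ℝ) ^ α ≤ 2 ^ β * (2 * y) ^ α := by gcongr
    _ = 2 ^ (α + β) * x := by
      rw [Real.mul_rpow (by norm_num) (by positivity), hyx, Real.rpow_add (by norm_num)]
      ring
    _ ≤ C * x := by
      gcongr
      exact le_max_right _ _
    _ ≤ 2 ^ (k + 1) := hk'.le
  refine ⟨2 ^ (k + 1) * m, isHadamardOrder_two_pow_mul hα hyp (Nat.succ_pos _) ?_, ?_, ?_⟩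
  · have hlog := Real.logb_le_logb_of_le (b := 2) (by norm_num) (by positivity) hpow
    rw [Real.logb_mul (by positivity) (by positivity), Real.logb_rpow (by norm_num) (by norm_num),
      Real.logb_rpow_eq_mul_logb_of_pos hm0, ← Real.rpow_natCast,
      Real.logb_rpow (by norm_num) (by norm_num)] at hlog
    linarith
  · exact Nat.lt_mul_div_succ n (by positivity)
  · have hle : ((2 ^ (k + 1) * (n / 2 ^ (k + 1)) : ℕ) : ℝ) ≤ n := by
      exact_mod_cast Nat.mul_div_le n _
    rw [hm]
    push_cast [pow_succ] at hle hk ⊢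
    nlinarith
end

section
/- If h is an even positive integer, then the central binomial coefficient satisfies C(h, h/2) > 2^h · √(2/(π·h)) · (1 − 1/(4h)). -/
/-- The sequence `(16 ^ m / (m * C(2m, m) ^ 2)) * (1 - 1 / (8 * m)) ^ 2`, at `m = n + 1`, expressed
through the partial Wallis products. -/
noncomputable def wallisCorrected (n : ℕ) : ℝ :=
  Real.Wallis.W (n + 1) * (((2 * n + 3) / (n + 1)) * (1 - 1 / (8 * (n + 1))) ^ 2)

theorem wallisCorrected_strictMono : StrictMono wallisCorrected := by
  refine strictMono_nat_of_lt_succ fun n => ?_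
  unfold wallisCorrected
  rw [Real.Wallis.W_succ (n + 1), mul_assoc]
  refine mul_lt_mul_of_pos_left ?_ (Real.Wallis.W_pos _)
  push_cast
  have hn : (0 : ℝ) ≤ n := n.cast_nonneg
  generalize (n : ℝ) = x at hn
  rw [← sub_pos]
  have key : (2 * (x + 1) + 2) / (2 * (x + 1) + 1) * ((2 * (x + 1) + 2) / (2 * (x + 1) + 3)) *
      ((2 * (x + 1) + 3) / (x + 1 + 1) * (1 - 1 / (8 * (x + 1 + 1))) ^ 2) -
      (2 * x + 3) / (x + 1) * (1 - 1 / (8 * (x + 1))) ^ 2 =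
      (8 * x ^ 2 + 27 * x + 18) / (64 * (2 * x + 3) * (x + 2) * (x + 1) ^ 3) := by
    have h1 : x + 1 ≠ 0 := by positivity
    have h2 : x + 2 ≠ 0 := by positivity
    have h3 : 2 * x + 3 ≠ 0 := by positivity
    have h5 : 2 * x + 5 ≠ 0 := by positivity
    rw [show x + 1 + 1 = x + 2 by ring, show 2 * (x + 1) + 1 = 2 * x + 3 by ring,
      show 2 * (x + 1) + 3 = 2 * x + 5 by ring]
    field_simp
    ring
  rw [key]
  positivity

open Filter Topology in
theorem tendsto_wallisCorrected : Tendsto wallisCorrected atTop (𝓝 Real.pi) := by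
  have hinv : Tendsto (fun n : ℕ => 1 / ((n : ℝ) + 1)) atTop (𝓝 0) :=
    tendsto_one_div_add_atTop_nhds_zero_nat
  have hW := Real.Wallis.tendsto_W_nhds_pi_div_two.comp (tendsto_add_atTop_nat 1)
  have hlim := hW.mul ((hinv.const_add 2).mul (((hinv.const_mul (1 / 8)).const_sub 1).pow 2))
  convert hlim using 2 with n
  · have hn : (n : ℝ) + 1 ≠ 0 := by positivity
    simp only [wallisCorrected, Function.comp_apply]
    congr 1
    field_simp
    ring
  · ring

theorem wallisCorrected_lt_pi (n : ℕ) : wallisCorrected n < Real.pi :=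
  (wallisCorrected_strictMono n.lt_succ_self).trans_le
    (wallisCorrected_strictMono.monotone.ge_of_tendsto tendsto_wallisCorrected _)

theorem Real.Wallis.W_eq_centralBinom (n : ℕ) :
    Real.Wallis.W n = 16 ^ n / ((n.centralBinom : ℝ) ^ 2 * (2 * n + 1)) := by
  have hfac : ((2 * n).factorial : ℝ) = n.centralBinom * n.factorial ^ 2 := by
    have := Nat.choose_mul_factorial_mul_factorial (show n ≤ 2 * n by omega)
    rw [show 2 * n - n = n by omega, ← Nat.centralBinom_eq_two_mul_choose] at this
    rw [← this]
    push_cast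
    ring
  have hc : (n.centralBinom : ℝ) ≠ 0 := by exact_mod_cast n.centralBinom_ne_zero
  have hf : (n.factorial : ℝ) ≠ 0 := by exact_mod_cast n.factorial_ne_zero
  rw [W_eq_factorial_ratio, hfac, pow_mul]
  norm_num
  field_simp

theorem central_binom_lower_bound (h : ℕ) (hpos : 0 < h) (heven : Even h) :
    (Nat.choose h (h / 2) : ℝ) >
      2 ^ h * Real.sqrt (2 / (Real.pi * h)) * (1 - 1 / (4 * h)) := by
  obtain ⟨m, rfl⟩ := heven.two_dvd
  obtain ⟨n, rfl⟩ : ∃ n, m = n + 1 := ⟨m - 1, by omega⟩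
  rw [Nat.mul_div_cancel_left _ two_pos, ← Nat.centralBinom_eq_two_mul_choose]
  have hc : (0 : ℝ) < (n + 1).centralBinom := by exact_mod_cast (n + 1).centralBinom_pos
  have hlt := wallisCorrected_lt_pi n
  rw [wallisCorrected, Real.Wallis.W_eq_centralBinom] at hlt
  refine lt_of_pow_lt_pow_left₀ 2 hc.le ?_
  rw [mul_pow, mul_pow, Real.sq_sqrt (by positivity), ← pow_mul,
    show 2 * (n + 1) * 2 = 4 * (n + 1) by ring, pow_mul]
  generalize ((n + 1).centralBinom : ℝ) = c at hc hlt
  have hpi := Real.pi_pos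
  push_cast at hlt ⊢
  norm_num only at hlt ⊢
  have hn : (0 : ℝ) < n + 1 := by positivity
  have e : (16 : ℝ) ^ (n + 1) * (2 / (Real.pi * (2 * (n + 1)))) *
      (1 - 1 / (4 * (2 * ((n : ℝ) + 1)))) ^ 2 =
      16 ^ (n + 1) / (c ^ 2 * (2 * ((n : ℝ) + 1) + 1)) *
        ((2 * n + 3) / (n + 1) * (1 - 1 / (8 * (n + 1))) ^ 2) * (c ^ 2 / Real.pi) := by
    have h3 : 2 * (n : ℝ) + 3 ≠ 0 := by positivity
    rw [show 2 * ((n : ℝ) + 1) + 1 = 2 * n + 3 by ring,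
      show 4 * (2 * ((n : ℝ) + 1)) = 8 * (n + 1) by ring]
    field_simp
  rw [e]
  calc _ < Real.pi * (c ^ 2 / Real.pi) := mul_lt_mul_of_pos_right hlt (by positivity)
    _ = c ^ 2 := by field_simp
end

section
/- Let A = I − E be a real d×d matrix, where |e_{ij}| ≤ ε for all 1 ≤ i, j ≤ d, and suppose d·ε ≤ 1. Then det(A) ≥ 1 − d·ε. -/
/-- One step of Gaussian elimination: the determinant is the pivot times the determinant of its
Schur complement. -/
theorem Matrix.det_succ_eq_mul_det_schur {K : Type*} [Field K] {n : ℕ}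
    (A : Matrix (Fin (n + 1)) (Fin (n + 1)) K) (h : A 0 0 ≠ 0) :
    A.det = A 0 0 *
      (Matrix.of fun i j : Fin n => A i.succ j.succ - A i.succ 0 / A 0 0 * A 0 j.succ).det := by
  set c : Fin (n + 1) → K := Fin.cons 0 fun i => A i.succ 0 / A 0 0 with hc
  set B : Matrix (Fin (n + 1)) (Fin (n + 1)) K := Matrix.of fun i j => A i j - c i * A 0 j with hB
  have hAB : A.det = B.det :=
    Matrix.det_eq_of_forall_row_eq_smul_add_const c 0 (by simp [hc])
      (fun i j => by simp [hB, hc])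
  rw [hAB, Matrix.det_succ_column_zero, Fin.sum_univ_succ, Finset.sum_eq_zero]
  · simp [hB, hc, Matrix.submatrix]
  · intro i _
    simp [hB, hc, h]

theorem det_lower_bound_perturbed_identity (d : ℕ) (ε : ℝ)
    (E : Matrix (Fin d) (Fin d) ℝ) (hE : ∀ i j, |E i j| ≤ ε)
    (hdε : (d : ℝ) * ε ≤ 1) :
    (1 - E).det ≥ 1 - (d : ℝ) * ε := by
  induction d generalizing ε with
  | zero => simp
  | succ n ih =>
    have hε : 0 ≤ ε := (abs_nonneg _).trans (hE 0 0)
    rcases n.eq_zero_or_pos with rfl | hn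
    · have := (le_abs_self _).trans (hE 0 0)
      simp
      linarith
    have hn' : (1 : ℝ) ≤ n := by exact_mod_cast hn
    push_cast at hdε ⊢
    have hε1 : 0 < 1 - ε := by nlinarith
    have hpivot : 1 - ε ≤ 1 - E 0 0 := by linarith [(le_abs_self _).trans (hE 0 0)]
    have hpos : 0 < 1 - E 0 0 := hε1.trans_le hpivot
    set F : Matrix (Fin n) (Fin n) ℝ := Matrix.of fun i j =>
      E i.succ j.succ + E i.succ 0 / (1 - E 0 0) * E 0 j.succ with hF
    have hdet : (1 - E).det = (1 - E 0 0) * (1 - F).det := by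
      rw [Matrix.det_succ_eq_mul_det_schur _ (by simpa using hpos.ne')]
      congr 2
      ext i j
      simp [hF, Matrix.one_apply, (Fin.succ_ne_zero j).symm]
      ring
    have hFbound : ∀ i j, |F i j| ≤ ε / (1 - ε) := fun i j => by
      calc |F i j| ≤ |E i.succ j.succ| + |E i.succ 0| / (1 - E 0 0) * |E 0 j.succ| := by
            simpa [hF, abs_mul, abs_div, abs_of_pos hpos] using
              abs_add_le (E i.succ j.succ) (E i.succ 0 / (1 - E 0 0) * E 0 j.succ)
        _ ≤ ε + ε / (1 - ε) * ε := by gcongr <;> apply hE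
        _ = ε / (1 - ε) := by field_simp; ring
    have hle : (n : ℝ) * (ε / (1 - ε)) ≤ 1 := by
      rw [← mul_div_assoc, div_le_one hε1]
      linarith
    calc (1 - E).det = (1 - E 0 0) * (1 - F).det := hdet
      _ ≥ (1 - ε) * (1 - n * (ε / (1 - ε))) :=
        mul_le_mul hpivot (ih _ F hFbound hle) (by linarith) hpos.le
      _ = 1 - (n + 1) * ε := by field_simp; ring
end

section
/- Let A be a real d×d matrix such that |a_{ij}| ≤ ε·|a_{ii}| for all i ≠ j (where ε is a real number). Then |det(A)| ≥ (∏_{i=1}^{d} |a_{ii}|) · (1 − (d−1)²·ε²). -/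
/-- One step of Gaussian elimination: the determinant is the pivot times the determinant of its
Schur complement. -/
theorem Matrix.det_eq_pivot_mul_det_schur {K : Type*} [Field K] {n : ℕ}
    (A : Matrix (Fin (n + 1)) (Fin (n + 1)) K) (h : A 0 0 ≠ 0) :
    A.det = A 0 0 *
      (Matrix.of fun i j : Fin n ↦
        A i.succ j.succ - A i.succ 0 / A 0 0 * A 0 j.succ).det := by
  let c : Fin (n + 1) → K := Fin.cons 0 fun i ↦ A i.succ 0 / A 0 0
  let B : Matrix (Fin (n + 1)) (Fin (n + 1)) K := Matrix.of fun i j ↦ A i j - c i * A 0 j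
  have hAB : A.det = B.det :=
    Matrix.det_eq_of_forall_row_eq_smul_add_const c 0 rfl fun i j ↦ by simp [B, c]
  have hcol (i : Fin n) : B i.succ 0 = 0 := by simp [B, c, h]
  rw [hAB, Matrix.det_succ_column_zero, Fin.sum_univ_succ]
  have h00 : B 0 0 = A 0 0 := by simp [B, c]
  simp only [hcol, h00, Fin.val_zero, pow_zero, one_mul, mul_zero, zero_mul,
    Finset.sum_const_zero, add_zero]
  congr 2

/-- If every off-diagonal entry is at most `ε` times the diagonal entry of its row and
`n * ε < 1`, the determinant is at least that of the extremal matrix, whose off-diagonal entries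
are all `-ε` times the diagonal ones. -/
theorem Matrix.prod_diag_mul_le_abs_det {n : ℕ} {ε : ℝ}
    (A : Matrix (Fin (n + 1)) (Fin (n + 1)) ℝ) (hε : 0 ≤ ε) (hn : n * ε < 1)
    (hA : ∀ i j, i ≠ j → |A i j| ≤ ε * |A i i|) :
    (∏ i, |A i i|) * ((1 - n * ε) * (1 + ε) ^ n) ≤ |A.det| := by
  induction n generalizing ε with
  | zero => simp
  | succ n ih =>
    by_cases h0 : A 0 0 = 0
    · simp [Fin.prod_univ_succ, h0]
    have hp : 0 < |A 0 0| := abs_pos.mpr h0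
    push_cast at hn ⊢
    have hε1 : ε < 1 := by nlinarith [mul_nonneg n.cast_nonneg hε]
    have h1 : 0 < 1 - ε := by linarith
    let S : Matrix (Fin (n + 1)) (Fin (n + 1)) ℝ :=
      Matrix.of fun i j ↦ A i.succ j.succ - A i.succ 0 / A 0 0 * A 0 j.succ
    have hcorr (i j : Fin (n + 1)) :
        |A i.succ 0 / A 0 0 * A 0 j.succ| ≤ ε ^ 2 * |A i.succ i.succ| := by
      rw [abs_mul, abs_div]
      calc _ ≤ ε * |A i.succ i.succ| / |A 0 0| * (ε * |A 0 0|) := by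
            gcongr
            · exact hA _ _ (Fin.succ_ne_zero i)
            · exact hA _ _ (Fin.succ_ne_zero j).symm
        _ = _ := by field_simp
    have hdiag (i : Fin (n + 1)) : (1 - ε ^ 2) * |A i.succ i.succ| ≤ |S i i| := by
      have := abs_sub_abs_le_abs_sub (A i.succ i.succ) (A i.succ 0 / A 0 0 * A 0 i.succ)
      have := hcorr i i
      simp only [S, Matrix.of_apply]
      linarith
    have hoff (i j : Fin (n + 1)) (hij : i ≠ j) : |S i j| ≤ ε / (1 - ε) * |S i i| := by
      have hsub := abs_sub (A i.succ j.succ) (A i.succ 0 / A 0 0 * A 0 j.succ)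
      have := hcorr i j
      have := hA i.succ j.succ (by simpa using hij)
      calc |S i j| ≤ (ε + ε ^ 2) * |A i.succ i.succ| := by
            simp only [S, Matrix.of_apply]
            linarith
        _ = ε / (1 - ε) * ((1 - ε ^ 2) * |A i.succ i.succ|) := by
            field_simp
            ring
        _ ≤ _ := by
            gcongr
            exact hdiag i
    have hsmall : n * (ε / (1 - ε)) < 1 := by
      rw [← mul_div_assoc, div_lt_one h1]
      linarith
    have hS := ih S (by positivity) hsmall hoff
    have hprod : (1 - ε ^ 2) ^ (n + 1) * ∏ i : Fin (n + 1), |A i.succ i.succ| ≤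
        ∏ i, |S i i| := by
      have hpow : (1 - ε ^ 2) ^ (n + 1) = ∏ _i : Fin (n + 1), (1 - ε ^ 2) := by simp
      rw [hpow, ← Finset.prod_mul_distrib]
      exact Finset.prod_le_prod
        (fun i _ ↦ mul_nonneg (by nlinarith) (abs_nonneg _)) fun i _ ↦ hdiag i
    rw [Matrix.det_eq_pivot_mul_det_schur A h0, abs_mul, Fin.prod_univ_succ, mul_assoc]
    refine mul_le_mul_of_nonneg_left (le_trans ?_ hS) hp.le
    have hfac : (1 - ε ^ 2) ^ (n + 1) *
        ((1 - n * (ε / (1 - ε))) * (1 + ε / (1 - ε)) ^ n) =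
          (1 - (n + 1) * ε) * (1 + ε) ^ (n + 1) := by
      have hinv : 1 + ε / (1 - ε) = 1 / (1 - ε) := by
        field_simp
        ring
      have hsq : 1 - ε ^ 2 = (1 - ε) * (1 + ε) := by ring
      rw [hinv, hsq, mul_pow, div_pow, one_pow]
      field_simp
      ring
    rw [← hfac]
    calc _ = ((1 - ε ^ 2) ^ (n + 1) * ∏ i : Fin (n + 1), |A i.succ i.succ|) *
          ((1 - n * (ε / (1 - ε))) * (1 + ε / (1 - ε)) ^ n) := by ring
      _ ≤ _ := by
        refine mul_le_mul_of_nonneg_right hprod (mul_nonneg ?_ (by positivity))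
        linarith

theorem det_lower_bound_diagonally_dominant (d : ℕ) (ε : ℝ)
    (A : Matrix (Fin d) (Fin d) ℝ)
    (hA : ∀ i j, i ≠ j → |A i j| ≤ ε * |A i i|) :
    |A.det| ≥ (∏ i : Fin d, |A i i|) * (1 - ((d : ℝ) - 1) ^ 2 * ε ^ 2) := by
  have hP : 0 ≤ ∏ i, |A i i| := Finset.prod_nonneg fun i _ ↦ abs_nonneg _
  rcases d with _ | n
  · simp [sq_nonneg]
  push_cast
  rw [add_sub_cancel_right, ge_iff_le]
  rcases n with _ | n
  · simp
  rcases lt_or_ge ε 0 with hε | hε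
  · have h0 : |A 0 0| = 0 := by
      have := hA 0 1 (by simp)
      nlinarith [abs_nonneg (A 0 1), abs_nonneg (A 0 0)]
    simp [Fin.prod_univ_succ, abs_eq_zero.mp h0]
  rcases lt_or_ge (((n + 1 : ℕ) : ℝ) * ε) 1 with hn | hn
  · refine le_trans (mul_le_mul_of_nonneg_left ?_ hP) (A.prod_diag_mul_le_abs_det hε hn hA)
    have hbern := one_add_mul_le_pow (by linarith : -2 ≤ ε) (n + 1)
    have := mul_le_mul_of_nonneg_left hbern (sub_nonneg.mpr hn.le)
    linarith
  · refine le_trans (mul_nonpos_of_nonneg_of_nonpos hP ?_) (abs_nonneg _)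
    nlinarith
end
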